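/- arXiv:1805.02954 — 5 statements merged into one kernel-verified Lean document; each statement's English description precedes it below -/
import Mathlib

section
/- The set ℝ^m⟨⟨X_δ⟩⟩ of formal power series δ + c with c ∈ ℝ^m⟨⟨X⟩⟩ forms a group under the composition product c_δ ∘ d_δ := δ + (d + c ∘̃ d), with identity element δ. Equivalently, the binary operation c ⊚ d := d + c ∘̃ d on ℝ^m⟨⟨X⟩⟩ is associative, has 0 as a two-sided identity, and every c ∈ ℝ^m⟨⟨X⟩⟩ has a two-sided inverse c^{-1} ∈ ℝ^m⟨⟨X⟩⟩, i.e., c ⊚ c^{-1} = c^{-1} ⊚ c = 0 (equivalently c^{-1} = (−c) ∘̃ c^{-1} and c = (−c^{-1}) ∘̃ c). -/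
/-!
STATEMENT 0: The set ℝ^m⟨⟨X_δ⟩⟩ forms a group under the composition product;
equivalently, c ⊚ d := d + c ∘̃ d on ℝ^m⟨⟨X⟩⟩ is associative, has 0 as a two-sided
identity, and every c has a two-sided inverse.
-/

open scoped BigOperators

namespace FliessStmt

/-- Words over the alphabet `X = {x_0, …, x_m}`. -/
abbrev Word (m : ℕ) := List (Fin (m + 1))

/-- Formal power series over `X`: coefficient functions on words. -/
abbrev Series (m : ℕ) := Word m → ℝ

noncomputable section

variable (m : ℕ)

/-- The series `1 = 1∅`. -/
def one : Series m := fun ν => if ν = [] then 1 else 0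

/-- Left catenation by the letter `x_i`:  `e ↦ x_i e`. -/
def cat (i : Fin (m + 1)) (e : Series m) : Series m := fun ν =>
  match ν with
  | [] => 0
  | j :: ν' => if j = i then e ν' else 0

/-- The shuffle product of two words, as a formal power series (a polynomial):
`(x_i η) ⧢ (x_j ξ) = x_i(η ⧢ (x_j ξ)) + x_j((x_i η) ⧢ ξ)`, `∅ ⧢ η = η ⧢ ∅ = η`. -/
def shw : Word m → Word m → Series m
  | [], ξ => fun ν => if ν = ξ then 1 else 0
  | η, [] => fun ν => if ν = η then 1 else 0
  | i :: η, j :: ξ => cat m i (shw η (j :: ξ)) + cat m j (shw (i :: η) ξ)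
  termination_by η ξ => η.length + ξ.length

/-- The shuffle product, extended bilinearly to formal power series. -/
def sh (c d : Series m) : Series m := fun ν =>
  ∑ᶠ p : Word m × Word m, c p.1 * d p.2 * shw m p.1 p.2 ν

/-- For `d ∈ ℝ^m⟨⟨X⟩⟩`, the component `d_i` with the convention `d_0 := 0`. -/
def dsel (d : Fin m → Series m) (i : Fin (m + 1)) : Series m :=
  if h : i = 0 then 0 else d (i.pred h)

/-- `φ_d(x_i)(e) = x_i e + x_0 (d_i ⧢ e)`. -/
def phiStep (d : Fin m → Series m) (i : Fin (m + 1)) (e : Series m) : Series m :=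
  cat m i e + cat m 0 (sh m (dsel m d i) e)

/-- The homomorphism `φ_d` on words, `φ_d(∅) = id`, `φ_d(x_i η) = φ_d(x_i) ∘ φ_d(η)`. -/
def phi (d : Fin m → Series m) : Word m → Series m → Series m
  | [], e => e
  | i :: η, e => phiStep m d i (phi d η e)

/-- The modified composition product `c ∘̃ d = Σ_η (c,η) φ_d(η)(1)`
(the sum is locally finite, hence given coefficientwise by a finite sum). -/
def modcomp (c : Series m) (d : Fin m → Series m) : Series m := fun ν =>
  ∑ᶠ η : Word m, c η * phi m d η (one m) ν

/-- The modified composition product, componentwise for vector-valued `c`. -/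
def modcompV {ℓ : ℕ} (c : Fin ℓ → Series m) (d : Fin m → Series m) : Fin ℓ → Series m :=
  fun j => modcomp m (c j) d

/-- The group product `c ⊚ d := d + c ∘̃ d` on `ℝ^m⟨⟨X⟩⟩`
(so that `c_δ ∘ d_δ = δ + c ⊚ d`). -/
def gprod (c d : Fin m → Series m) : Fin m → Series m :=
  d + modcompV m c d

section Auxiliary

variable {m}

/-- The left derivative `x_j⁻¹ e`, whose coefficient at `ν` is that of `e` at `x_j ν`. -/
def lder (j : Fin (m + 1)) (e : Series m) : Series m := fun ν => e (j :: ν)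

/-- Two series agree on all words of length less than `n`. -/
def Agree (n : ℕ) (a b : Series m) : Prop := ∀ ν : Word m, ν.length < n → a ν = b ν

theorem Agree.mono {k n : ℕ} {a b : Series m} (h : Agree n a b) (hk : k ≤ n) : Agree k a b :=
  fun ν hν => h ν (hν.trans_le hk)

theorem Agree.lder {n : ℕ} {a b : Series m} (h : Agree (n + 1) a b) (j : Fin (m + 1)) :
    Agree n (lder j a) (lder j b) :=
  fun ν hν => h (j :: ν) (by simpa using hν)

theorem agree_zero (a b : Series m) : Agree 0 a b := fun _ hν => absurd hν (Nat.not_lt_zero _)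

theorem agree_succ {n : ℕ} {a b : Series m} (h0 : a [] = b [])
    (h : ∀ j, Agree n (FliessStmt.lder j a) (FliessStmt.lder j b)) : Agree (n + 1) a b := by
  rintro (_ | ⟨j, ν⟩) hν
  · exact h0
  · exact h j ν (by simpa using hν)

theorem eq_of_agree {a b : Series m} (h : ∀ n, Agree n a b) : a = b :=
  funext fun ν => h (ν.length + 1) ν (Nat.lt_succ_self _)

/-! ### Finite sums over words -/

theorem finsum_eq_finsum_comp {α β : Type*} {f : α → ℝ} {g : β → α}
    (hg : Function.Injective g) (hf : ∀ x, f x ≠ 0 → x ∈ Set.range g) :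
    ∑ᶠ x, f x = ∑ᶠ y, f (g y) := by
  rw [← finsum_mem_range hg, ← finsum_mem_univ]
  exact finsum_mem_inter_support_eq' _ _ _ fun x hx => by simpa using hf x hx

theorem finsum_cat (i : Fin (m + 1)) (f : Word m → ℝ) : ∑ᶠ η, cat m i f η = ∑ᶠ η, f η := by
  rw [finsum_eq_finsum_comp (List.cons_injective (a := i))]
  · simp [cat]
  · rintro (_ | ⟨j, ν⟩) h
    · simp [cat] at h
    · have : j = i := by
        by_contra hji
        simp [cat, hji] at h
      exact ⟨ν, by rw [this]⟩

/-! ### The shuffle product -/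

theorem shw_nil_right (η : Word m) : shw m η [] = fun ν => if ν = η then 1 else 0 := by
  cases η <;> simp [shw]

theorem shw_apply_nil (η ξ : Word m) :
    shw m η ξ [] = if η = [] ∧ ξ = [] then 1 else 0 := by
  cases η <;> cases ξ <;> simp [shw, cat]

theorem shw_apply_cons (η ξ : Word m) (j : Fin (m + 1)) (ν : Word m) :
    shw m η ξ (j :: ν) =
      cat m j (fun η' => shw m η' ξ ν) η + cat m j (fun ξ' => shw m η ξ' ν) ξ := by
  rcases η with _ | ⟨i, η⟩ <;> rcases ξ with _ | ⟨k, ξ⟩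
  · simp [shw, cat]
  · simp [shw, cat, eq_comm (a := j), ite_and]
  · simp [shw_nil_right, cat, eq_comm (a := j), ite_and]
  · simp [shw, cat, eq_comm (a := j)]

theorem length_add_length_of_shw_ne_zero (ν : Word m) :
    ∀ η ξ : Word m, shw m η ξ ν ≠ 0 → η.length + ξ.length = ν.length := by
  induction ν with
  | nil =>
    intro η ξ h
    rw [shw_apply_nil] at h
    have h' : η = [] ∧ ξ = [] := by
      by_contra hc
      simp [hc] at h
    simp [h'.1, h'.2]
  | cons j ν ih =>
    intro η ξ h
    rw [shw_apply_cons] at h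
    have h' : cat m j (fun η' => shw m η' ξ ν) η ≠ 0 ∨
        cat m j (fun ξ' => shw m η ξ' ν) ξ ≠ 0 := by
      by_contra! hc
      exact h (by rw [hc.1, hc.2, add_zero])
    rcases h' with h' | h'
    · rcases η with _ | ⟨i, η⟩
      · simp [cat] at h'
      · simp only [cat, ne_eq, ite_eq_right_iff, Classical.not_imp] at h'
        have := ih _ _ h'.2
        simp only [List.length_cons]
        omega
    · rcases ξ with _ | ⟨i, ξ⟩
      · simp [cat] at h'
      · simp only [cat, ne_eq, ite_eq_right_iff, Classical.not_imp] at h'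
        have := ih _ _ h'.2
        simp only [List.length_cons]
        omega

theorem finite_pairs_length_le (n : ℕ) :
    {p : Word m × Word m | p.1.length ≤ n ∧ p.2.length ≤ n}.Finite :=
  (List.finite_length_le (Fin (m + 1)) n).prod (List.finite_length_le (Fin (m + 1)) n)

theorem sh_nil (c d : Series m) : sh m c d [] = c [] * d [] := by
  rw [sh, finsum_eq_single _ (([], []) : Word m × Word m)]
  · simp [shw_apply_nil]
  · rintro ⟨η, ξ⟩ h
    have : ¬ (η = [] ∧ ξ = []) := by simpa using h
    simp [shw_apply_nil, this]

theorem finsum_pair_cat_fst (c d : Series m) (j : Fin (m + 1)) (ν : Word m) :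
    ∑ᶠ p : Word m × Word m, c p.1 * d p.2 * cat m j (fun η' => shw m η' p.2 ν) p.1 =
      sh m (lder j c) d ν := by
  rw [finsum_eq_finsum_comp (g := fun p : Word m × Word m => (j :: p.1, p.2))]
  · simp [cat, sh, lder]
  · rintro ⟨a, b⟩ ⟨a', b'⟩ h
    simpa using h
  · rintro ⟨_ | ⟨i, η⟩, ξ⟩ h
    · simp [cat] at h
    · have : i = j := by
        by_contra hij
        simp [cat, hij] at h
      exact ⟨(η, ξ), by simp [this]⟩

theorem finsum_pair_cat_snd (c d : Series m) (j : Fin (m + 1)) (ν : Word m) :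
    ∑ᶠ p : Word m × Word m, c p.1 * d p.2 * cat m j (fun ξ' => shw m p.1 ξ' ν) p.2 =
      sh m c (lder j d) ν := by
  rw [finsum_eq_finsum_comp (g := fun p : Word m × Word m => (p.1, j :: p.2))]
  · simp [cat, sh, lder]
  · rintro ⟨a, b⟩ ⟨a', b'⟩ h
    simpa using h
  · rintro ⟨η, _ | ⟨i, ξ⟩⟩ h
    · simp [cat] at h
    · have : i = j := by
        by_contra hij
        simp [cat, hij] at h
      exact ⟨(η, ξ), by simp [this]⟩

theorem lder_sh (c d : Series m) (j : Fin (m + 1)) :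
    lder j (sh m c d) = sh m (lder j c) d + sh m c (lder j d) := by
  funext ν
  simp only [Pi.add_apply]
  rw [← finsum_pair_cat_fst, ← finsum_pair_cat_snd, ← finsum_add_distrib]
  · simp only [lder, sh, shw_apply_cons, mul_add]
  · refine (finite_pairs_length_le (ν.length + 1)).subset ?_
    rintro ⟨_ | ⟨i, η⟩, ξ⟩ h
    · simp [cat] at h
    · have h' : shw m η ξ ν ≠ 0 := by
        intro hc
        simp [cat, hc] at h
      have := length_add_length_of_shw_ne_zero _ _ _ h'
      simp only [Set.mem_ofPred_eq, List.length_cons]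
      omega
  · refine (finite_pairs_length_le (ν.length + 1)).subset ?_
    rintro ⟨η, _ | ⟨i, ξ⟩⟩ h
    · simp [cat] at h
    · have h' : shw m η ξ ν ≠ 0 := by
        intro hc
        simp [cat, hc] at h
      have := length_add_length_of_shw_ne_zero _ _ _ h'
      simp only [Set.mem_ofPred_eq, List.length_cons]
      omega

theorem sh_cons (c d : Series m) (j : Fin (m + 1)) (ν : Word m) :
    sh m c d (j :: ν) = sh m (lder j c) d ν + sh m c (lder j d) ν :=
  congrFun (lder_sh c d j) ν

theorem sh_comm (a b : Series m) : sh m a b = sh m b a := by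
  funext ν
  induction ν generalizing a b with
  | nil => rw [sh_nil, sh_nil, mul_comm]
  | cons j ν ih => rw [sh_cons, sh_cons, ih, ih a, add_comm]

theorem sh_linearCombination_apply {ι : Type*} (s : Finset ι) (r : ι → ℝ) (a : Series m)
    (f : ι → Series m) (ν : Word m) :
    sh m a (∑ i ∈ s, r i • f i) ν = ∑ i ∈ s, r i * sh m a (f i) ν := by
  induction ν generalizing a f with
  | nil =>
    simp only [sh_nil, Finset.sum_apply, Pi.smul_apply, smul_eq_mul, Finset.mul_sum]
    exact Finset.sum_congr rfl fun i _ => by ring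
  | cons j ν ih =>
    have h : lder j (∑ i ∈ s, r i • f i) = ∑ i ∈ s, r i • lder j (f i) := by
      funext ξ
      simp [lder, Finset.sum_apply]
    simp only [sh_cons, h, ih, mul_add, Finset.sum_add_distrib]

theorem sh_sum {ι : Type*} (s : Finset ι) (a : Series m) (f : ι → Series m) :
    sh m a (∑ i ∈ s, f i) = ∑ i ∈ s, sh m a (f i) := by
  funext ν
  simpa [Finset.sum_apply] using sh_linearCombination_apply s (fun _ => 1) a f ν

theorem sum_sh {ι : Type*} (s : Finset ι) (a : Series m) (f : ι → Series m) :
    sh m (∑ i ∈ s, f i) a = ∑ i ∈ s, sh m (f i) a := by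
  simp only [sh_comm _ a, sh_sum]

theorem sh_zero (a : Series m) : sh m a 0 = 0 := by
  simpa using sh_sum (∅ : Finset ℕ) a fun _ => 0

theorem zero_sh (a : Series m) : sh m 0 a = 0 := by
  rw [sh_comm, sh_zero]

theorem sh_add (a b c : Series m) : sh m a (b + c) = sh m a b + sh m a c := by
  simpa [Fin.sum_univ_two] using sh_sum Finset.univ a ![b, c]

theorem add_sh (a b c : Series m) : sh m (a + b) c = sh m a c + sh m b c := by
  rw [sh_comm, sh_add, sh_comm c, sh_comm c]

theorem sh_assoc (a b c : Series m) : sh m (sh m a b) c = sh m a (sh m b c) := by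
  funext ν
  induction ν generalizing a b c with
  | nil => simp only [sh_nil, mul_assoc]
  | cons j ν ih =>
    simp only [sh_cons, lder_sh, add_sh, sh_add, Pi.add_apply, ih]
    ring

theorem Agree.sh {n : ℕ} {a a' b b' : Series m} (ha : Agree n a a') (hb : Agree n b b') :
    Agree n (sh m a b) (sh m a' b') := by
  induction n generalizing a a' b b' with
  | zero => exact agree_zero _ _
  | succ n ih =>
    refine agree_succ ?_ fun j => ?_
    · rw [sh_nil, sh_nil, ha [] (by simp), hb [] (by simp)]
    · intro ν hν
      simp only [lder_sh, Pi.add_apply]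
      rw [ih (ha.lder j) (hb.mono n.le_succ) ν hν, ih (ha.mono n.le_succ) (hb.lder j) ν hν]

/-! ### The modified composition product -/

theorem phi_apply_eq_zero (d : Fin m → Series m) (η : Word m) :
    Agree η.length (phi m d η (one m)) 0 := by
  induction η with
  | nil => exact agree_zero _ _
  | cons i η ih =>
    refine agree_succ (by simp [phi, phiStep, cat]) fun j ν hν => ?_
    have h : FliessStmt.sh m (dsel m d i) (phi m d η (one m)) ν = 0 := by
      rw [Agree.sh (fun _ _ => rfl) ih ν hν, sh_zero, Pi.zero_apply]
    have h' := ih ν hν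
    simp only [Pi.zero_apply] at h'
    simp [phi, phiStep, cat, lder, h, h']

theorem support_mul_phi_subset (c : Series m) (d : Fin m → Series m) (ν : Word m) :
    (Function.support fun η => c η * phi m d η (one m) ν) ⊆ {η | η.length ≤ ν.length} := by
  intro η hη
  by_contra hc
  exact hη (by simp [phi_apply_eq_zero d η ν (by simpa using hc)])

/-- The words of length at most `n`. -/
def wordsLE (n : ℕ) : Finset (Word m) := (List.finite_length_le (Fin (m + 1)) n).toFinset

theorem modcomp_agree_sum (c : Series m) (d : Fin m → Series m) (n : ℕ) :
    Agree (n + 1) (modcomp m c d) (∑ η ∈ wordsLE n, c η • phi m d η (one m)) := by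
  intro ν hν
  rw [modcomp, finsum_eq_sum_of_support_subset (s := wordsLE n)]
  · simp [Finset.sum_apply]
  · refine (support_mul_phi_subset c d ν).trans fun η hη => ?_
    simp only [Set.mem_ofPred_eq] at hη
    simp only [wordsLE, Set.Finite.coe_toFinset, Set.mem_ofPred_eq]
    omega

theorem sh_modcomp_apply (a c : Series m) (d : Fin m → Series m) (ν : Word m) :
    sh m a (modcomp m c d) ν = ∑ᶠ η, c η * sh m a (phi m d η (one m)) ν := by
  rw [Agree.sh (fun _ _ => rfl) (modcomp_agree_sum c d ν.length) ν (Nat.lt_succ_self _),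
    sh_linearCombination_apply, finsum_eq_sum_of_support_subset]
  intro η hη
  by_contra hc
  refine hη ?_
  have hlen : ν.length < η.length := by simpa [wordsLE] using hc
  simp [Agree.sh (fun _ _ => rfl) (phi_apply_eq_zero d η) ν hlen, sh_zero]

theorem modcomp_nil (c : Series m) (d : Fin m → Series m) : modcomp m c d [] = c [] := by
  rw [modcomp, finsum_eq_single _ []]
  · simp [phi, one]
  · rintro (_ | ⟨i, η⟩) h
    · exact absurd rfl h
    · simp [phi, phiStep, cat]

theorem lder_modcomp (c : Series m) (d : Fin m → Series m) (j : Fin (m + 1)) :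
    lder j (modcomp m c d) = modcomp m (lder j c) d +
      if j = 0 then ∑ i, sh m (dsel m d i) (modcomp m (lder i c) d) else 0 := by
  funext ν
  have key : ∀ η : Word m, c η * phi m d η (one m) (j :: ν) =
      ∑ i, cat m i (fun η' => c (i :: η') * phi m d (i :: η') (one m) (j :: ν)) η := by
    rintro (_ | ⟨i, η⟩)
    · simp [phi, one, cat]
    · simp [cat]
  have hfin : ∀ (n : ℕ) (f : Word m → ℝ), (∀ η, n < η.length → f η = 0) →
      Function.HasFiniteSupport f := fun n f hf =>
    (List.finite_length_le (Fin (m + 1)) n).subset fun η hη => by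
      by_contra hc
      exact hη (hf η (by simpa using hc))
  have hphi : ∀ i η, phi m d (i :: η) (one m) (j :: ν) =
      (if i = j then phi m d η (one m) ν else 0) +
        if j = 0 then sh m (dsel m d i) (phi m d η (one m)) ν else 0 := by
    intro i η
    simp [phi, phiStep, cat, eq_comm]
  have hz : ∀ η : Word m, ν.length < η.length → phi m d η (one m) ν = 0 :=
    fun η hη => phi_apply_eq_zero d η ν hη
  have hz' : ∀ (a : Series m) (η : Word m), ν.length < η.length →
      sh m a (phi m d η (one m)) ν = 0 := fun a η hη => by
    simp [Agree.sh (fun _ _ => rfl) (phi_apply_eq_zero d η) ν hη, sh_zero]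
  have hterm : ∀ i, ∑ᶠ η, cat m i
      (fun η' => c (i :: η') * phi m d (i :: η') (one m) (j :: ν)) η =
      (if i = j then modcomp m (lder i c) d ν else 0) +
        if j = 0 then sh m (dsel m d i) (modcomp m (lder i c) d) ν else 0 := by
    intro i
    rw [finsum_cat]
    simp only [hphi, mul_add]
    rw [finsum_add_distrib]
    · congr 1
      · split_ifs <;> simp [modcomp, lder]
      · split_ifs <;> simp [sh_modcomp_apply, lder]
    · exact hfin ν.length _ fun η hη => by simp [hz η hη]
    · exact hfin ν.length _ fun η hη => by simp [hz' _ η hη]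
  have hsum : lder j (modcomp m c d) ν =
      ∑ᶠ η : Word m, c η * phi m d η (one m) (j :: ν) := rfl
  rw [hsum, finsum_congr key, finsum_sum_comm]
  · simp only [hterm, Finset.sum_add_distrib, Finset.sum_ite_eq', Finset.mem_univ, if_true,
      Pi.add_apply]
    split_ifs <;> simp [Finset.sum_apply]
  · refine fun i _ => hfin (ν.length + 1) _ ?_
    rintro (_ | ⟨k, η⟩) hη
    · simp [cat]
    · have hlt : ν.length < η.length := by simpa using hη
      simp [cat, hphi, hz η hlt, hz' _ η hlt]

theorem modcomp_zero_left (d : Fin m → Series m) : modcomp m 0 d = 0 := by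
  funext ν
  simp [modcomp]

theorem modcomp_add (a b : Series m) (d : Fin m → Series m) :
    modcomp m (a + b) d = modcomp m a d + modcomp m b d := by
  funext ν
  simp only [modcomp, Pi.add_apply, add_mul]
  exact finsum_add_distrib
    ((List.finite_length_le _ _).subset (support_mul_phi_subset a d ν))
    ((List.finite_length_le _ _).subset (support_mul_phi_subset b d ν))

theorem modcomp_neg (a : Series m) (d : Fin m → Series m) :
    modcomp m (-a) d = -modcomp m a d := by
  rw [eq_neg_iff_add_eq_zero, ← modcomp_add, neg_add_cancel, modcomp_zero_left]

theorem modcomp_sum {ι : Type*} (s : Finset ι) (f : ι → Series m) (d : Fin m → Series m) :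
    modcomp m (∑ i ∈ s, f i) d = ∑ i ∈ s, modcomp m (f i) d :=
  map_sum (⟨⟨fun a => modcomp m a d, modcomp_zero_left d⟩, fun a b => modcomp_add a b d⟩ :
    Series m →+ Series m) f s

theorem dsel_add (d e : Fin m → Series m) (i : Fin (m + 1)) :
    dsel m (d + e) i = dsel m d i + dsel m e i := by
  by_cases h : i = 0 <;> simp [dsel, h]

theorem dsel_zero_index (d : Fin m → Series m) : dsel m d 0 = 0 := by
  simp [dsel]

theorem dsel_modcompV (d e : Fin m → Series m) (i : Fin (m + 1)) :
    dsel m (modcompV m d e) i = modcomp m (dsel m d i) e := by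
  by_cases h : i = 0 <;> simp [dsel, h, modcompV, modcomp_zero_left]

theorem Agree.dsel {n : ℕ} {d d' : Fin m → Series m} (h : ∀ k, Agree n (d k) (d' k))
    (i : Fin (m + 1)) : Agree n (dsel m d i) (dsel m d' i) := by
  by_cases hi : i = 0
  · simp [FliessStmt.dsel, hi, Agree]
  · simpa [FliessStmt.dsel, hi] using h _

theorem Agree.add {n : ℕ} {a a' b b' : Series m} (ha : Agree n a a') (hb : Agree n b b') :
    Agree n (a + b) (a' + b') :=
  fun ν hν => by simp [ha ν hν, hb ν hν]

theorem Agree.sum {n : ℕ} {ι : Type*} {s : Finset ι} {f g : ι → Series m}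
    (h : ∀ i, Agree n (f i) (g i)) : Agree n (∑ i ∈ s, f i) (∑ i ∈ s, g i) :=
  fun ν hν => by
    simp only [Finset.sum_apply]
    exact Finset.sum_congr rfl fun i _ => h i ν hν

theorem Agree.ite_zero {n : ℕ} {p : Prop} [Decidable p] {a b : Series m} (h : Agree n a b) :
    Agree n (if p then a else 0) (if p then b else 0) := by
  split_ifs
  exacts [h, fun _ _ => rfl]

/-- The modified composition product is a contraction in its right argument. -/
theorem Agree.modcomp {n : ℕ} {d d' : Fin m → Series m} (h : ∀ k, Agree n (d k) (d' k))
    (c : Series m) : Agree (n + 1) (modcomp m c d) (modcomp m c d') := by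
  induction n generalizing c with
  | zero =>
    exact agree_succ (by rw [modcomp_nil, modcomp_nil]) fun j => agree_zero _ _
  | succ n ih =>
    have ih' := ih fun k => (h k).mono n.le_succ
    refine agree_succ (by rw [modcomp_nil, modcomp_nil]) fun j => ?_
    rw [lder_modcomp, lder_modcomp]
    exact (ih' _).add (Agree.ite_zero (Agree.sum fun i => (Agree.dsel h i).sh (ih' _)))

theorem modcomp_zero_right (c : Series m) : modcomp m c 0 = c := by
  refine eq_of_agree fun n => ?_
  induction n generalizing c with
  | zero => exact agree_zero _ _
  | succ n ih =>
    refine agree_succ (modcomp_nil _ _) fun j => ?_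
    have : ∀ i, dsel m 0 i = 0 := fun i => by simp [dsel]
    rw [lder_modcomp]
    simpa [this, zero_sh] using ih (lder j c)

/-- Modified composition on the right is a homomorphism for the shuffle product. -/
theorem modcomp_sh (a b : Series m) (d : Fin m → Series m) :
    modcomp m (sh m a b) d = sh m (modcomp m a d) (modcomp m b d) := by
  refine eq_of_agree fun n => ?_
  induction n generalizing a b with
  | zero => exact agree_zero _ _
  | succ n ih =>
    refine agree_succ (by simp only [modcomp_nil, sh_nil]) fun j => ?_
    have hder : ∀ i, Agree n (modcomp m (lder i (sh m a b)) d)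
        (sh m (modcomp m (lder i a) d) (modcomp m b d) +
          sh m (modcomp m a d) (modcomp m (lder i b) d)) := fun i => by
      rw [lder_sh, modcomp_add]
      exact (ih _ _).add (ih _ _)
    have hrhs : lder j (sh m (modcomp m a d) (modcomp m b d)) =
        (sh m (modcomp m (lder j a) d) (modcomp m b d) +
          sh m (modcomp m a d) (modcomp m (lder j b) d)) +
        if j = 0 then ∑ i, sh m (dsel m d i)
          (sh m (modcomp m (lder i a) d) (modcomp m b d) +
            sh m (modcomp m a d) (modcomp m (lder i b) d)) else 0 := by
      have hswap : ∀ x y z : Series m, sh m x (sh m y z) = sh m y (sh m x z) := fun x y z => by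
        rw [← sh_assoc, sh_comm x y, sh_assoc]
      rw [lder_sh, lder_modcomp, lder_modcomp]
      split_ifs
      · simp only [add_sh, sh_add, sum_sh, sh_sum, sh_assoc, Finset.sum_add_distrib,
          hswap (modcomp m a d)]
        abel
      · simp
    rw [lder_modcomp, hrhs]
    exact (hder j).add
      (Agree.ite_zero (Agree.sum fun i => Agree.sh (fun _ _ => rfl) (hder i)))

/-- Mixed associativity of the modified composition product. -/
theorem modcomp_modcomp (c : Series m) (d e : Fin m → Series m) :
    modcomp m (modcomp m c d) e = modcomp m c (gprod m d e) := by
  refine eq_of_agree fun n => ?_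
  induction n generalizing c with
  | zero => exact agree_zero _ _
  | succ n ih =>
    refine agree_succ (by simp only [modcomp_nil]) fun j => ?_
    have hsel : ∀ i, sh m (dsel m e i) (modcomp m (lder i (modcomp m c d)) e) =
        sh m (dsel m e i) (modcomp m (modcomp m (lder i c) d) e) := fun i => by
      by_cases hi : i = 0
      · simp only [hi, dsel_zero_index, zero_sh]
      · simp only [lder_modcomp, hi, if_false, add_zero]
    have hlhs : lder j (modcomp m (modcomp m c d) e) =
        modcomp m (modcomp m (lder j c) d) e +
        if j = 0 then ∑ i, sh m (dsel m (gprod m d e) i)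
          (modcomp m (modcomp m (lder i c) d) e) else 0 := by
      rw [lder_modcomp, Finset.sum_congr rfl fun i _ => hsel i, lder_modcomp c, modcomp_add]
      split_ifs
      · simp only [modcomp_sum, modcomp_sh, gprod, dsel_add, dsel_modcompV, add_sh,
          Finset.sum_add_distrib]
        abel
      · simp [modcomp_zero_left]
    rw [hlhs, lder_modcomp]
    exact (ih _).add (Agree.ite_zero (Agree.sum fun i => Agree.sh (fun _ _ => rfl) (ih _)))

/-! ### The group structure -/

theorem gprod_assoc (c d e : Fin m → Series m) :
    gprod m (gprod m c d) e = gprod m c (gprod m d e) := by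
  funext k
  simp only [gprod, modcompV, Pi.add_apply, modcomp_add, modcomp_modcomp, add_assoc]

theorem gprod_zero (c : Fin m → Series m) : gprod m c 0 = c := by
  funext k
  simp [gprod, modcompV, modcomp_zero_right]

theorem zero_gprod (c : Fin m → Series m) : gprod m 0 c = c := by
  funext k
  simp [gprod, modcompV, modcomp_zero_left]

theorem modcompV_neg (c d : Fin m → Series m) : modcompV m (-c) d = -modcompV m c d := by
  funext k
  simp [modcompV, modcomp_neg]

/-- The Picard iterates of `d ↦ (-c) ∘̃ d`, converging to the inverse of `c`. -/
def picard (c : Fin m → Series m) : ℕ → Fin m → Series m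
  | 0 => 0
  | n + 1 => modcompV m (-c) (picard c n)

theorem picard_agree (c : Fin m → Series m) {n p : ℕ} (h : n ≤ p) (k : Fin m) :
    Agree n (picard c n k) (picard c p k) := by
  induction n generalizing p k with
  | zero => exact agree_zero _ _
  | succ n ih =>
    obtain ⟨p, rfl⟩ : ∃ q, p = q + 1 := ⟨p - 1, by omega⟩
    exact Agree.modcomp (ih (by omega)) _

theorem exists_eq_modcompV (c : Fin m → Series m) :
    ∃ d : Fin m → Series m, d = modcompV m (-c) d := by
  refine ⟨fun k ν => picard c (ν.length + 1) k ν, ?_⟩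
  funext k ν
  refine (Agree.modcomp (n := ν.length) (fun i ξ hξ => ?_) ((-c) k) ν (Nat.lt_succ_self _)).symm
  exact picard_agree c hξ i ξ (Nat.lt_succ_self _)

theorem exists_gprod_eq_zero (c : Fin m → Series m) : ∃ d, gprod m c d = 0 := by
  obtain ⟨d, hd⟩ := exists_eq_modcompV c
  refine ⟨d, ?_⟩
  rw [modcompV_neg] at hd
  rw [gprod, ← eq_neg_iff_add_eq_zero]
  exact hd

theorem eq_modcompV_neg_of_gprod_eq_zero {c d : Fin m → Series m} (h : gprod m c d = 0) :
    d = modcompV m (-c) d := by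
  rw [modcompV_neg]
  exact eq_neg_of_add_eq_zero_left h

end Auxiliary

/-- `(ℝ^m⟨⟨X_δ⟩⟩, ∘, δ)` is a group: the operation
`c ⊚ d = d + c ∘̃ d` is associative, `0` is a two-sided identity, and every `c`
has a two-sided inverse `c⁻¹`, which moreover satisfies the fixed point
identities `c⁻¹ = (−c) ∘̃ c⁻¹` and `c = (−c⁻¹) ∘̃ c`. -/
theorem output_feedback_group (m : ℕ) :
    (∀ c d e : Fin m → Series m, gprod m (gprod m c d) e = gprod m c (gprod m d e)) ∧
    (∀ c : Fin m → Series m, gprod m c 0 = c ∧ gprod m 0 c = c) ∧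
    (∀ c : Fin m → Series m, ∃ ci : Fin m → Series m,
      gprod m c ci = 0 ∧ gprod m ci c = 0 ∧
      ci = modcompV m (-c) ci ∧ c = modcompV m (-ci) c) := by
  refine ⟨gprod_assoc, fun c => ⟨gprod_zero c, zero_gprod c⟩, fun c => ?_⟩
  obtain ⟨ci, h⟩ := exists_gprod_eq_zero c
  obtain ⟨cii, h'⟩ := exists_gprod_eq_zero ci
  have hc : cii = c := by
    rw [← zero_gprod cii, ← h, gprod_assoc, h', gprod_zero]
  rw [hc] at h'
  exact ⟨ci, h, h', eq_modcompV_neg_of_gprod_eq_zero h, eq_modcompV_neg_of_gprod_eq_zero h'⟩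

end

end FliessStmt
end

section
/- In the Hopf algebra H of coordinate functions, for any nonempty word η = x_{i_1}⋯x_{i_n} ∈ X* and any 1 ≤ k ≤ m, the antipode satisfies S(a^k_η) = (−1)^{n+1} θ̃'_{i_n} ∘ ⋯ ∘ θ̃'_{i_1}(a^k_∅), where θ̃'_l := −θ̃_l + δ_{0l} Σ_{j=1}^m A^{(j)} ∘ θ̃_j, i.e., θ̃'_l(h) = −θ̃_l(h) + δ_{0l} Σ_{j=1}^m a^j_∅ θ̃_j(h). -/
open scoped TensorProduct BigOperators

namespace FeedbackHopf

/-- Words over the alphabet `X = {x_0, …, x_m}`. -/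
abbrev Word (m : ℕ) := List (Fin (m + 1))

/-- `H`: the free commutative polynomial ℝ-algebra on the coordinate-function
generators `a^k_η`, `η ∈ X*`, `1 ≤ k ≤ m`. -/
abbrev H (m : ℕ) := MvPolynomial (Fin m × Word m) ℝ

noncomputable section

variable (m : ℕ)

/-- The generator (coordinate function) `a^k_η`. -/
def gen (k : Fin m) (η : Word m) : H m := MvPolynomial.X (k, η)

/-- The right-shift map `θ̃_j`: the derivation of `H` with `θ̃_j a^k_η = a^k_{η x_j}`. -/
def theta (j : Fin (m + 1)) : H m →ₗ[ℝ] H m :=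
  (MvPolynomial.mkDerivation ℝ fun p : Fin m × Word m =>
    (MvPolynomial.X (p.1, p.2 ++ [j]) : H m)).toLinearMap

/-- The map `A^{(j)} : H → H`, multiplication by `a^j_∅`. -/
def Ae (j : Fin m) : H m →ₗ[ℝ] H m := LinearMap.mulRight ℝ (gen m j [])

/-- `Θ̃_i := θ̃_i ⊗ id + id ⊗ θ̃_i + δ_{0i} Σ_{j=1}^m θ̃_j ⊗ A^{(j)}` on `H ⊗ H`. -/
def thetaT (i : Fin (m + 1)) : H m ⊗[ℝ] H m →ₗ[ℝ] H m ⊗[ℝ] H m :=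
  TensorProduct.map (theta m i) LinearMap.id
    + TensorProduct.map LinearMap.id (theta m i)
    + (if i = 0 then ∑ j : Fin m, TensorProduct.map (theta m j.succ) (Ae m j) else 0)

/-- `Θ̃_η := Θ̃_{i_n} ∘ ⋯ ∘ Θ̃_{i_1}` for `η = x_{i_1} ⋯ x_{i_n}`, `Θ̃_∅ = id`. -/
def thetaTw : Word m → (H m ⊗[ℝ] H m →ₗ[ℝ] H m ⊗[ℝ] H m)
  | [] => LinearMap.id
  | i :: η => thetaTw η ∘ₗ thetaT m i

/-- The coproduct `Δ`, defined on generators by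
`Δ a^l_η := Θ̃_η (a^l_∅ ⊗ 1 + 1 ⊗ a^l_∅)` and extended as an algebra morphism. -/
def Delta : H m →ₐ[ℝ] H m ⊗[ℝ] H m :=
  MvPolynomial.aeval fun p : Fin m × Word m =>
    thetaTw m p.2 (gen m p.1 [] ⊗ₜ[ℝ] 1 + 1 ⊗ₜ[ℝ] gen m p.1 [])

/-- The counit `ε`, with `ε(a^k_η) = 0` and `ε(1) = 1`. -/
def counit : H m →ₐ[ℝ] ℝ := MvPolynomial.aeval fun _ => (0 : ℝ)

/-- `θ̃'_l := −θ̃_l + δ_{0l} Σ_{j=1}^m A^{(j)} ∘ θ̃_j`. -/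
def thetaP (l : Fin (m + 1)) : H m →ₗ[ℝ] H m :=
  -theta m l + (if l = 0 then ∑ j : Fin m, Ae m j ∘ₗ theta m j.succ else 0)

/-- `Θ̃'_η := θ̃'_{i_n} ∘ ⋯ ∘ θ̃'_{i_1}` for `η = x_{i_1} ⋯ x_{i_n}`. -/
def thetaPw : Word m → (H m →ₗ[ℝ] H m)
  | [] => LinearMap.id
  | i :: η => thetaPw η ∘ₗ thetaP m i

lemma theta_gen (i : Fin (m + 1)) (k : Fin m) (η : Word m) :
    theta m i (gen m k η) = gen m k (η ++ [i]) := by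
  simp [theta, gen]

lemma theta_algebraMap (i : Fin (m + 1)) (r : ℝ) : theta m i (algebraMap ℝ (H m) r) = 0 :=
  Derivation.map_algebraMap _ r

lemma theta_mul (i : Fin (m + 1)) (f g : H m) :
    theta m i (f * g) = f * theta m i g + theta m i f * g := by
  have h := Derivation.leibniz (MvPolynomial.mkDerivation ℝ fun p : Fin m × Word m =>
    (MvPolynomial.X (p.1, p.2 ++ [i]) : H m)) f g
  rw [smul_eq_mul, smul_eq_mul, mul_comm g] at h
  exact h

lemma thetaT_tmul (i : Fin (m + 1)) (f g : H m) :
    thetaT m i (f ⊗ₜ[ℝ] g) = theta m i f ⊗ₜ[ℝ] g + f ⊗ₜ[ℝ] theta m i g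
      + if i = 0 then ∑ j : Fin m, theta m j.succ f ⊗ₜ[ℝ] (g * gen m j []) else 0 := by
  split_ifs with h <;> simp [thetaT, h, Ae, LinearMap.sum_apply]

lemma thetaT_succ_tmul (j : Fin m) (f g : H m) :
    thetaT m j.succ (f ⊗ₜ[ℝ] g) = theta m j.succ f ⊗ₜ[ℝ] g + f ⊗ₜ[ℝ] theta m j.succ g := by
  simp [thetaT_tmul]

lemma thetaT_mul (i : Fin (m + 1)) (s t : H m ⊗[ℝ] H m) :
    thetaT m i (s * t) = s * thetaT m i t + thetaT m i s * t := by
  induction s with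
  | zero => simp
  | add s s' hs hs' => simp only [add_mul, map_add, hs, hs']; abel
  | tmul a b =>
    induction t with
    | zero => simp
    | add t t' ht ht' => simp only [mul_add, map_add, ht, ht']; abel
    | tmul c d =>
      rw [Algebra.TensorProduct.tmul_mul_tmul, thetaT_tmul, thetaT_tmul, thetaT_tmul]
      split_ifs
      · simp only [mul_add, add_mul, Finset.mul_sum, Finset.sum_mul, theta_mul,
          Algebra.TensorProduct.tmul_mul_tmul, TensorProduct.add_tmul, TensorProduct.tmul_add,
          Finset.sum_add_distrib, mul_assoc, mul_comm (gen m _ []) d]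
        abel
      · simp only [mul_add, add_mul, theta_mul, add_zero,
          Algebra.TensorProduct.tmul_mul_tmul, TensorProduct.add_tmul, TensorProduct.tmul_add]
        abel

lemma thetaT_one (i : Fin (m + 1)) : thetaT m i 1 = 0 := by
  have h := thetaT_mul m i 1 1
  simpa using h

lemma thetaTw_append_singleton (η : Word m) (i : Fin (m + 1)) :
    thetaTw m (η ++ [i]) = thetaT m i ∘ₗ thetaTw m η := by
  induction η with
  | nil => rfl
  | cons a η ih => simp only [List.cons_append, thetaTw, ih, LinearMap.comp_assoc]

lemma thetaPw_append_singleton (η : Word m) (i : Fin (m + 1)) :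
    thetaPw m (η ++ [i]) = thetaP m i ∘ₗ thetaPw m η := by
  induction η with
  | nil => rfl
  | cons a η ih => simp only [List.cons_append, thetaPw, ih, LinearMap.comp_assoc]

lemma Delta_gen (k : Fin m) (η : Word m) :
    Delta m (gen m k η) = thetaTw m η (gen m k [] ⊗ₜ[ℝ] 1 + 1 ⊗ₜ[ℝ] gen m k []) := by
  simp [Delta, gen]

lemma Delta_gen_nil (k : Fin m) :
    Delta m (gen m k []) = gen m k [] ⊗ₜ[ℝ] 1 + 1 ⊗ₜ[ℝ] gen m k [] :=
  Delta_gen m k []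

/-- The coproduct intertwines `θ̃_i` and `Θ̃_i`. -/
lemma Delta_theta (i : Fin (m + 1)) (h : H m) :
    Delta m (theta m i h) = thetaT m i (Delta m h) := by
  induction h using MvPolynomial.induction_on with
  | C r =>
    rw [← MvPolynomial.algebraMap_eq, theta_algebraMap, AlgHom.commutes,
      Algebra.algebraMap_eq_smul_one, map_smul, thetaT_one, smul_zero, map_zero]
  | add p q hp hq => simp only [map_add, hp, hq]
  | mul_X p x hp =>
    have hx : Delta m (theta m i (gen m x.1 x.2)) = thetaT m i (Delta m (gen m x.1 x.2)) := by
      rw [theta_gen, Delta_gen, Delta_gen, thetaTw_append_singleton, LinearMap.comp_apply]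
    change Delta m (theta m i (p * gen m x.1 x.2)) = thetaT m i (Delta m (p * gen m x.1 x.2))
    rw [theta_mul, map_add, map_mul, map_mul, map_mul, thetaT_mul, hp, hx]

lemma counit_theta (i : Fin (m + 1)) (h : H m) : counit m (theta m i h) = 0 := by
  induction h using MvPolynomial.induction_on with
  | C r => rw [← MvPolynomial.algebraMap_eq, theta_algebraMap, map_zero]
  | add p q hp hq => simp only [map_add, hp, hq, add_zero]
  | mul_X p x hp =>
    change counit m (theta m i (p * gen m x.1 x.2)) = 0
    rw [theta_mul, theta_gen, map_add, map_mul, map_mul, hp]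
    simp [counit, gen]

/-- The operator on `H ⊗ (H ⊗ H)` induced by `θ̃_i` through the iterated coproduct. -/
def thetaTT (i : Fin (m + 1)) :
    H m ⊗[ℝ] (H m ⊗[ℝ] H m) →ₗ[ℝ] H m ⊗[ℝ] (H m ⊗[ℝ] H m) :=
  TensorProduct.map (theta m i) LinearMap.id
    + TensorProduct.map LinearMap.id (thetaT m i)
    + (if i = 0 then ∑ j : Fin m, TensorProduct.map (theta m j.succ)
        (LinearMap.mulRight ℝ (Delta m (gen m j []))) else 0)

lemma thetaTT_tmul (i : Fin (m + 1)) (f : H m) (t : H m ⊗[ℝ] H m) :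
    thetaTT m i (f ⊗ₜ[ℝ] t) = theta m i f ⊗ₜ[ℝ] t + f ⊗ₜ[ℝ] thetaT m i t
      + if i = 0 then ∑ j : Fin m, theta m j.succ f ⊗ₜ[ℝ] (t * Delta m (gen m j [])) else 0 := by
  split_ifs with h <;> simp [thetaTT, h, LinearMap.sum_apply]

lemma lTensor_Delta_thetaT (i : Fin (m + 1)) (t : H m ⊗[ℝ] H m) :
    (Delta m).toLinearMap.lTensor (H m) (thetaT m i t)
      = thetaTT m i ((Delta m).toLinearMap.lTensor (H m) t) := by
  induction t with
  | zero => simp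
  | add s t hs ht => simp only [map_add, hs, ht]
  | tmul f g =>
    rw [thetaT_tmul, LinearMap.lTensor_tmul, thetaTT_tmul]
    split_ifs <;> simp [Delta_theta]

lemma assoc_thetaT_tmul (i : Fin (m + 1)) (u : H m ⊗[ℝ] H m) (g : H m) :
    thetaTT m i (TensorProduct.assoc ℝ (H m) (H m) (H m) (u ⊗ₜ[ℝ] g))
      = TensorProduct.assoc ℝ (H m) (H m) (H m) (thetaT m i u ⊗ₜ[ℝ] g + u ⊗ₜ[ℝ] theta m i g
        + if i = 0 then ∑ j : Fin m, thetaT m j.succ u ⊗ₜ[ℝ] (g * gen m j []) else 0) := by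
  induction u with
  | zero => simp
  | add u v hu hv =>
    rw [TensorProduct.add_tmul, map_add, map_add, hu, hv, ← map_add]
    congr 1
    split_ifs
    · simp only [map_add, TensorProduct.add_tmul, Finset.sum_add_distrib]
      abel
    · simp only [map_add, TensorProduct.add_tmul]
      abel
  | tmul p q =>
    rw [TensorProduct.assoc_tmul, thetaTT_tmul, thetaT_tmul, thetaT_tmul]
    split_ifs
    · simp only [thetaT_succ_tmul, Delta_gen_nil, mul_add, Algebra.TensorProduct.tmul_mul_tmul,
        mul_one, TensorProduct.add_tmul, TensorProduct.tmul_add, TensorProduct.sum_tmul,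
        TensorProduct.tmul_sum, map_add, map_sum, TensorProduct.assoc_tmul,
        Finset.sum_add_distrib]
      abel
    · simp only [add_zero, TensorProduct.add_tmul, TensorProduct.tmul_add, map_add,
        TensorProduct.assoc_tmul]
      abel

lemma assoc_rTensor_Delta_thetaT (i : Fin (m + 1)) (t : H m ⊗[ℝ] H m) :
    TensorProduct.assoc ℝ (H m) (H m) (H m)
        ((Delta m).toLinearMap.rTensor (H m) (thetaT m i t))
      = thetaTT m i (TensorProduct.assoc ℝ (H m) (H m) (H m)
          ((Delta m).toLinearMap.rTensor (H m) t)) := by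
  induction t with
  | zero => simp
  | add s t hs ht => simp only [map_add, hs, ht]
  | tmul f g =>
    rw [thetaT_tmul, LinearMap.rTensor_tmul, assoc_thetaT_tmul]
    split_ifs <;> simp [Delta_theta]

lemma Delta_coassoc_gen (k : Fin m) (η : Word m) :
    TensorProduct.assoc ℝ (H m) (H m) (H m)
        ((Delta m).toLinearMap.rTensor (H m) (Delta m (gen m k η)))
      = (Delta m).toLinearMap.lTensor (H m) (Delta m (gen m k η)) := by
  induction η using List.reverseRecOn with
  | nil =>
    simp only [Delta_gen_nil, map_add, LinearMap.rTensor_tmul, LinearMap.lTensor_tmul,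
      AlgHom.toLinearMap_apply, map_one, Algebra.TensorProduct.one_def, TensorProduct.add_tmul,
      TensorProduct.tmul_add, TensorProduct.assoc_tmul]
    abel
  | append_singleton η i ih =>
    rw [← theta_gen, Delta_theta, assoc_rTensor_Delta_thetaT, lTensor_Delta_thetaT, ih]

/-- Coassociativity of the coproduct. -/
lemma Delta_coassoc (h : H m) :
    TensorProduct.assoc ℝ (H m) (H m) (H m)
        ((Delta m).toLinearMap.rTensor (H m) (Delta m h))
      = (Delta m).toLinearMap.lTensor (H m) (Delta m h) := by
  have key : ((Algebra.TensorProduct.assoc ℝ ℝ ℝ (H m) (H m) (H m)).toAlgHom.comp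
      (Algebra.TensorProduct.map (Delta m) (AlgHom.id ℝ (H m)))).comp (Delta m)
      = (Algebra.TensorProduct.map (AlgHom.id ℝ (H m)) (Delta m)).comp (Delta m) :=
    MvPolynomial.algHom_ext fun x => Delta_coassoc_gen m x.1 x.2
  exact DFunLike.congr_fun key h

variable {m}

/-- The convolution product of linear endomorphisms of `H`. -/
def conv (f g : H m →ₗ[ℝ] H m) : H m →ₗ[ℝ] H m :=
  LinearMap.mul' ℝ (H m) ∘ₗ TensorProduct.map f g ∘ₗ (Delta m).toLinearMap

lemma mul_map_mul_map_tmul (f g h : H m →ₗ[ℝ] H m) (u : H m ⊗[ℝ] H m) (q : H m) :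
    LinearMap.mul' ℝ (H m) (TensorProduct.map f g u) * h q
      = LinearMap.mul' ℝ (H m) ((LinearMap.mul' ℝ (H m)).lTensor (H m)
          (TensorProduct.map f (TensorProduct.map g h)
            (TensorProduct.assoc ℝ (H m) (H m) (H m) (u ⊗ₜ[ℝ] q)))) := by
  induction u with
  | zero => simp
  | add u v hu hv => simp only [map_add, add_mul, TensorProduct.add_tmul, hu, hv]
  | tmul a b => simp [mul_assoc]

lemma mul_map_conv_left (f g h : H m →ₗ[ℝ] H m) (t : H m ⊗[ℝ] H m) :
    LinearMap.mul' ℝ (H m) (TensorProduct.map (conv f g) h t)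
      = LinearMap.mul' ℝ (H m) ((LinearMap.mul' ℝ (H m)).lTensor (H m)
          (TensorProduct.map f (TensorProduct.map g h)
            (TensorProduct.assoc ℝ (H m) (H m) (H m)
              ((Delta m).toLinearMap.rTensor (H m) t)))) := by
  induction t with
  | zero => simp
  | add s t hs ht => simp only [map_add, hs, ht]
  | tmul p q => exact mul_map_mul_map_tmul f g h (Delta m p) q

lemma mul_map_conv_right (f g h : H m →ₗ[ℝ] H m) (t : H m ⊗[ℝ] H m) :
    LinearMap.mul' ℝ (H m) (TensorProduct.map f (conv g h) t)
      = LinearMap.mul' ℝ (H m) ((LinearMap.mul' ℝ (H m)).lTensor (H m)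
          (TensorProduct.map f (TensorProduct.map g h)
            ((Delta m).toLinearMap.lTensor (H m) t))) := by
  induction t with
  | zero => simp
  | add s t hs ht => simp only [map_add, hs, ht]
  | tmul p q => simp [conv]

lemma conv_assoc (f g h : H m →ₗ[ℝ] H m) : conv (conv f g) h = conv f (conv g h) := by
  refine LinearMap.ext fun x => ?_
  have hl := mul_map_conv_left f g h (Delta m x)
  rw [Delta_coassoc, ← mul_map_conv_right] at hl
  exact hl

lemma rid_lTensor_counit_thetaT (i : Fin (m + 1)) (t : H m ⊗[ℝ] H m) :
    TensorProduct.rid ℝ (H m) ((counit m).toLinearMap.lTensor (H m) (thetaT m i t))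
      = theta m i (TensorProduct.rid ℝ (H m) ((counit m).toLinearMap.lTensor (H m) t)) := by
  induction t with
  | zero => simp
  | add s t hs ht => simp only [map_add, hs, ht]
  | tmul f g =>
    have hc (j : Fin m) : counit m (gen m j []) = 0 := by simp [counit, gen]
    rw [thetaT_tmul]
    split_ifs <;> simp [counit_theta, hc]

lemma rid_lTensor_counit_Delta_gen (k : Fin m) (η : Word m) :
    TensorProduct.rid ℝ (H m) ((counit m).toLinearMap.lTensor (H m) (Delta m (gen m k η)))
      = gen m k η := by
  induction η using List.reverseRecOn with
  | nil =>
    rw [Delta_gen_nil]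
    simp [counit, gen]
  | append_singleton η i ih =>
    rw [← theta_gen, Delta_theta, rid_lTensor_counit_thetaT, ih]

/-- Right counitality of the coproduct. -/
lemma rid_lTensor_counit_Delta (h : H m) :
    TensorProduct.rid ℝ (H m) ((counit m).toLinearMap.lTensor (H m) (Delta m h)) = h := by
  have key : ((Algebra.TensorProduct.rid ℝ ℝ (H m)).toAlgHom.comp
      (Algebra.TensorProduct.map (AlgHom.id ℝ (H m)) (counit m))).comp (Delta m)
      = AlgHom.id ℝ (H m) :=
    MvPolynomial.algHom_ext fun x => rid_lTensor_counit_Delta_gen x.1 x.2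
  exact DFunLike.congr_fun key h

lemma conv_counit (f : H m →ₗ[ℝ] H m) :
    conv f (Algebra.linearMap ℝ (H m) ∘ₗ (counit m).toLinearMap) = f := by
  have key (t : H m ⊗[ℝ] H m) : LinearMap.mul' ℝ (H m)
      (TensorProduct.map f (Algebra.linearMap ℝ (H m) ∘ₗ (counit m).toLinearMap) t)
      = f (TensorProduct.rid ℝ (H m) ((counit m).toLinearMap.lTensor (H m) t)) := by
    induction t with
    | zero => simp
    | add s t hs ht => simp only [map_add, hs, ht]
    | tmul p q =>
      simp only [TensorProduct.map_tmul, LinearMap.mul'_apply, LinearMap.comp_apply,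
        AlgHom.toLinearMap_apply, Algebra.linearMap_apply, LinearMap.lTensor_tmul,
        TensorProduct.rid_tmul, map_smul]
      rw [Algebra.smul_def, mul_comm]
  refine LinearMap.ext fun x => (key (Delta m x)).trans ?_
  rw [rid_lTensor_counit_Delta]

/-- The defect of the intertwining relation between `S` and `θ̃_i`. -/
def thetaDefect (S : H m →ₗ[ℝ] H m) (i : Fin (m + 1)) : H m →ₗ[ℝ] H m :=
  S ∘ₗ theta m i - theta m i ∘ₗ S
    + if i = 0 then ∑ j : Fin m, Ae m j ∘ₗ S ∘ₗ theta m j.succ else 0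

lemma mul_map_thetaT (S : H m →ₗ[ℝ] H m) (i : Fin (m + 1)) (t : H m ⊗[ℝ] H m) :
    LinearMap.mul' ℝ (H m) (TensorProduct.map S LinearMap.id (thetaT m i t))
      = theta m i (LinearMap.mul' ℝ (H m) (TensorProduct.map S LinearMap.id t))
        + LinearMap.mul' ℝ (H m) (TensorProduct.map (thetaDefect S i) LinearMap.id t) := by
  induction t with
  | zero => simp
  | add s t hs ht =>
    simp only [map_add, hs, ht]
    abel
  | tmul f g =>
    rw [thetaT_tmul]
    unfold thetaDefect
    split_ifs
    · simp only [map_add, map_sum, TensorProduct.map_tmul, LinearMap.mul'_apply, LinearMap.id_apply,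
        LinearMap.add_apply, LinearMap.sub_apply, LinearMap.sum_apply, LinearMap.comp_apply,
        theta_mul, Ae, LinearMap.mulRight_apply, add_mul, sub_mul, Finset.sum_mul]
      rw [Finset.sum_congr rfl fun j _ => show S (theta m j.succ f) * (g * gen m j [])
        = S (theta m j.succ f) * gen m j [] * g by ring]
      ring
    · simp only [add_zero, map_add, TensorProduct.map_tmul, LinearMap.mul'_apply,
        LinearMap.id_apply, LinearMap.sub_apply, LinearMap.comp_apply, theta_mul, sub_mul]
      ring

lemma thetaDefect_eq_zero {S : H m →ₗ[ℝ] H m}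
    (hl : conv S LinearMap.id = Algebra.linearMap ℝ (H m) ∘ₗ (counit m).toLinearMap)
    (hr : conv LinearMap.id S = Algebra.linearMap ℝ (H m) ∘ₗ (counit m).toLinearMap)
    (i : Fin (m + 1)) : thetaDefect S i = 0 := by
  have hz : conv (thetaDefect S i) LinearMap.id = 0 := by
    refine LinearMap.ext fun x => ?_
    have h := mul_map_thetaT S i (Delta m x)
    rw [← Delta_theta] at h
    change conv S LinearMap.id (theta m i x) = theta m i (conv S LinearMap.id x)
      + conv (thetaDefect S i) LinearMap.id x at h
    rw [hl] at h
    simp only [LinearMap.comp_apply, AlgHom.toLinearMap_apply, Algebra.linearMap_apply,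
      counit_theta, theta_algebraMap, map_zero, zero_add] at h
    exact h.symm
  rw [← conv_counit (thetaDefect S i), ← hr, ← conv_assoc, hz]
  simp [conv]

/-- An antipode intertwines `θ̃_i` and `-θ̃'_i`. -/
lemma antipode_theta {S : H m →ₗ[ℝ] H m}
    (hl : conv S LinearMap.id = Algebra.linearMap ℝ (H m) ∘ₗ (counit m).toLinearMap)
    (hr : conv LinearMap.id S = Algebra.linearMap ℝ (H m) ∘ₗ (counit m).toLinearMap)
    (i : Fin (m + 1)) (h : H m) : S (theta m i h) = -thetaP m i (S h) := by
  have hsucc (j : Fin m) : S ∘ₗ theta m j.succ = theta m j.succ ∘ₗ S := by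
    simpa [thetaDefect, sub_eq_zero] using thetaDefect_eq_zero hl hr j.succ
  have hi := DFunLike.congr_fun (thetaDefect_eq_zero hl hr i) h
  simp only [thetaDefect, hsucc] at hi
  unfold thetaP
  split_ifs at hi ⊢
  · simp only [LinearMap.add_apply, LinearMap.sub_apply, LinearMap.neg_apply, LinearMap.sum_apply,
      LinearMap.comp_apply, LinearMap.zero_apply] at hi ⊢
    linear_combination hi
  · simp only [LinearMap.add_apply, LinearMap.sub_apply, LinearMap.neg_apply,
      LinearMap.comp_apply, LinearMap.zero_apply] at hi ⊢
    linear_combination hi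

lemma antipode_gen_nil {S : H m →ₗ[ℝ] H m}
    (hl : conv S LinearMap.id = Algebra.linearMap ℝ (H m) ∘ₗ (counit m).toLinearMap)
    (k : Fin m) : S (gen m k []) = -gen m k [] := by
  have h1 : S 1 = 1 := by
    simpa [conv, Algebra.TensorProduct.one_def] using DFunLike.congr_fun hl 1
  have hk := DFunLike.congr_fun hl (gen m k [])
  simp only [conv, LinearMap.comp_apply, AlgHom.toLinearMap_apply, Delta_gen_nil, map_add,
    TensorProduct.map_tmul, LinearMap.mul'_apply, LinearMap.id_apply, h1, mul_one, one_mul] at hk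
  rw [eq_neg_iff_add_eq_zero, hk]
  simp [counit, gen]

lemma antipode_gen {S : H m →ₗ[ℝ] H m}
    (hl : conv S LinearMap.id = Algebra.linearMap ℝ (H m) ∘ₗ (counit m).toLinearMap)
    (hr : conv LinearMap.id S = Algebra.linearMap ℝ (H m) ∘ₗ (counit m).toLinearMap)
    (k : Fin m) (η : Word m) :
    S (gen m k η) = ((-1 : ℝ) ^ (η.length + 1)) • thetaPw m η (gen m k []) := by
  induction η using List.reverseRecOn with
  | nil => simpa [thetaPw] using antipode_gen_nil hl k
  | append_singleton η i ih =>
    rw [← theta_gen, antipode_theta hl hr, ih, thetaPw_append_singleton, map_smul,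
      LinearMap.comp_apply, List.length_append, List.length_singleton, pow_succ _ (η.length + 1),
      mul_neg_one, neg_smul]

/-- The antipode `S` of `H` (i.e. any linear map satisfying the
two antipode convolution identities) satisfies, for every nonempty word
`η = x_{i_1} ⋯ x_{i_n}` and every `1 ≤ k ≤ m`,
`S(a^k_η) = (−1)^{n+1} θ̃'_{i_n} ∘ ⋯ ∘ θ̃'_{i_1}(a^k_∅)`. -/
theorem antipode_formula (m : ℕ) (S : H m →ₗ[ℝ] H m)
    (hS₁ : LinearMap.mul' ℝ (H m) ∘ₗ LinearMap.rTensor (H m) S ∘ₗ (Delta m).toLinearMap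
      = Algebra.linearMap ℝ (H m) ∘ₗ (counit m).toLinearMap)
    (hS₂ : LinearMap.mul' ℝ (H m) ∘ₗ LinearMap.lTensor (H m) S ∘ₗ (Delta m).toLinearMap
      = Algebra.linearMap ℝ (H m) ∘ₗ (counit m).toLinearMap) :
    ∀ (η : Word m), η ≠ [] → ∀ k : Fin m,
      S (gen m k η) = ((-1 : ℝ) ^ (η.length + 1)) • thetaPw m η (gen m k []) := by
  exact fun η _ k => antipode_gen hS₁ hS₂ k η

end

end FeedbackHopf
end

section
/- If c and d are rational formal power series over finite sub-alphabets X_c and X_d of the extended alphabet X̄, then the quasi-shuffle product e = c ⊛ d is a rational series over the finite alphabet X_e = X_c ∪ X_d ∪ [X_c X_d], where [X_c X_d] = {[a b] : a ∈ X_c, b ∈ X_d}. In particular, if V_c and V_d are finite-dimensional subspaces stable under all left shifts and containing c and d respectively, then the span of {c̄_i ⊛ d̄_j} over bases {c̄_i} of V_c and {d̄_j} of V_d is a finite-dimensional left-shift-stable subspace containing e. -/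
open scoped BigOperators

namespace QShuffleExt

/-- The extended alphabet `X̄`: letters `x_A` are indexed by nonempty finite
multisets `A` of indices from `{0, 1, …, m}`; `x_i := x_{{i}}`. -/
abbrev Letter (m : ℕ) := {A : Multiset (Fin (m + 1)) // A ≠ 0}

/-- Words over the extended alphabet. -/
abbrev QWord (m : ℕ) := List (Letter m)

/-- Formal power series over `X̄`. -/
abbrev QSeries (m : ℕ) := QWord m → ℝ

noncomputable section

variable (m : ℕ)

/-- The commutative associative bracket `[x_A x_B] := x_{A ⊎ B}`. -/
def br (a b : Letter m) : Letter m :=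
  ⟨a.1 + b.1, fun h => a.2 (by
    have := congrArg Multiset.card h
    simp at this
    exact this.1)⟩

/-- Left catenation by a letter: `e ↦ a e`. -/
def cat (a : Letter m) (e : QSeries m) : QSeries m := fun ν =>
  match ν with
  | [] => 0
  | b :: ν' => if b = a then e ν' else 0

/-- The quasi-shuffle product of two words:
`(a v) ⊛ (b w) = a(v ⊛ (b w)) + b((a v) ⊛ w) − [a b](v ⊛ w)`,
`∅ ⊛ η = η ⊛ ∅ = η`. -/
def qshw : QWord m → QWord m → QSeries m
  | [], ξ => fun ν => if ν = ξ then 1 else 0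
  | η, [] => fun ν => if ν = η then 1 else 0
  | a :: v, b :: w =>
      cat m a (qshw v (b :: w)) + cat m b (qshw (a :: v) w)
        - cat m (br m a b) (qshw v w)
  termination_by v w => v.length + w.length

/-- The quasi-shuffle product, extended bilinearly to formal power series
(the extension is locally finite, hence well defined). -/
def qshS (c d : QSeries m) : QSeries m := fun ν =>
  ∑ᶠ p : QWord m × QWord m, c p.1 * d p.2 * qshw m p.1 p.2 ν

/-- The left-shift operator `a⁻¹` on series: `a⁻¹(c)(ν) = c(aν)`. -/
def leftShift (a : Letter m) (c : QSeries m) : QSeries m := fun ν => c (a :: ν)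

/-- A subspace of series is stable when it is closed under all left shifts. -/
def ShiftStable (V : Submodule ℝ (QSeries m)) : Prop :=
  ∀ a : Letter m, ∀ x ∈ V, leftShift m a x ∈ V

/-- `c` is a series over the finite sub-alphabet `X₀ ⊂ X̄`: its support only
contains words whose letters lie in `X₀`. -/
def SupportedOn (X₀ : Finset (Letter m)) (c : QSeries m) : Prop :=
  ∀ ν : QWord m, ¬ (∀ a ∈ ν, a ∈ X₀) → c ν = 0

/-- `c` is a rational series over the finite sub-alphabet `X₀ ⊂ X̄`: it is a
series over `X₀` lying in some finite-dimensional subspace stable under all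
left shifts. -/
def IsRationalOn (X₀ : Finset (Letter m)) (c : QSeries m) : Prop :=
  SupportedOn m X₀ c ∧
    ∃ V : Submodule ℝ (QSeries m),
      FiniteDimensional ℝ V ∧ ShiftStable m V ∧ c ∈ V

/-- The set of letters `[X_c X_d] = {[a b] : a ∈ X_c, b ∈ X_d}`. -/
def brSet (Xc Xd : Finset (Letter m)) : Finset (Letter m) :=
  (Xc ×ˢ Xd).image fun p => br m p.1 p.2

variable {m}

theorem finite_br_fiber (a : Letter m) :
    {q : Letter m × Letter m | br m q.1 q.2 = a}.Finite := by
  refine Set.Finite.of_finite_image (f := fun q => (q.1.1, q.2.1))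
    ((Multiset.antidiagonal a.1).toFinset.finite_toSet.subset ?_) ?_
  · rintro _ ⟨q, hq, rfl⟩
    simpa [br] using congrArg Subtype.val hq
  · rintro ⟨q₁, q₂⟩ _ ⟨r₁, r₂⟩ _ h
    simpa [Subtype.ext_iff] using h

/-- The pairs of letters whose bracket is `a`. -/
def brFiber (a : Letter m) : Finset (Letter m × Letter m) :=
  (finite_br_fiber a).toFinset

theorem mem_brFiber {a : Letter m} {q : Letter m × Letter m} :
    q ∈ brFiber a ↔ br m q.1 q.2 = a := by
  simp [brFiber]

/-- The coproduct dual to the quasi-shuffle product of words. -/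
def coprod : QWord m → (QWord m × QWord m →₀ ℝ)
  | [] => Finsupp.single ([], []) 1
  | a :: ν =>
      (coprod ν).mapDomain (Prod.map (a :: ·) id) + (coprod ν).mapDomain (Prod.map id (a :: ·))
        - ∑ q ∈ brFiber a, (coprod ν).mapDomain (Prod.map (q.1 :: ·) (q.2 :: ·))

section mapDomain

variable (F : QWord m × QWord m →₀ ℝ) (a b : Letter m) (η ξ : QWord m)

theorem mapDomain_cons_left_nil : F.mapDomain (Prod.map (a :: ·) id) ([], ξ) = 0 :=
  Finsupp.mapDomain_of_notMem_range _ _ (by simp)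

theorem mapDomain_cons_left_cons :
    F.mapDomain (Prod.map (a :: ·) id) (b :: η, ξ) = if a = b then F (η, ξ) else 0 := by
  split_ifs with h
  · subst h
    exact Finsupp.mapDomain_apply (f := Prod.map (a :: ·) id)
      ((List.cons_injective).prodMap Function.injective_id) F (η, ξ)
  · exact Finsupp.mapDomain_of_notMem_range _ _ (by simp [h])

theorem mapDomain_cons_right_nil : F.mapDomain (Prod.map id (a :: ·)) (η, []) = 0 :=
  Finsupp.mapDomain_of_notMem_range _ _ (by simp)

theorem mapDomain_cons_right_cons :
    F.mapDomain (Prod.map id (a :: ·)) (η, b :: ξ) = if a = b then F (η, ξ) else 0 := by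
  split_ifs with h
  · subst h
    exact Finsupp.mapDomain_apply (f := Prod.map id (a :: ·))
      (Function.injective_id.prodMap List.cons_injective) F (η, ξ)
  · exact Finsupp.mapDomain_of_notMem_range _ _ (by simp [h])

theorem mapDomain_cons_cons_nil_left :
    F.mapDomain (Prod.map (a :: ·) (b :: ·)) ([], ξ) = 0 :=
  Finsupp.mapDomain_of_notMem_range _ _ (by simp)

theorem mapDomain_cons_cons_nil_right :
    F.mapDomain (Prod.map (a :: ·) (b :: ·)) (η, []) = 0 :=
  Finsupp.mapDomain_of_notMem_range _ _ (by simp)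

theorem mapDomain_cons_cons_cons (q : Letter m × Letter m) :
    F.mapDomain (Prod.map (q.1 :: ·) (q.2 :: ·)) (a :: η, b :: ξ) =
      if q = (a, b) then F (η, ξ) else 0 := by
  split_ifs with h
  · subst h
    exact Finsupp.mapDomain_apply (f := Prod.map (a :: ·) (b :: ·))
      (List.cons_injective.prodMap List.cons_injective) F (η, ξ)
  · refine Finsupp.mapDomain_of_notMem_range _ _ ?_
    rintro ⟨r, hr⟩
    simp only [Prod.map, Prod.mk.injEq, List.cons.injEq] at hr
    exact h (Prod.ext hr.1.1 hr.2.1)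

end mapDomain

theorem qshw_nil_left (ξ ν : QWord m) : qshw m [] ξ ν = if ν = ξ then 1 else 0 := by
  rw [qshw]

theorem qshw_nil_right (η ν : QWord m) : qshw m η [] ν = if ν = η then 1 else 0 := by
  cases η <;> simp [qshw]

theorem coprod_apply (ν η ξ : QWord m) : coprod ν (η, ξ) = qshw m η ξ ν := by
  induction ν generalizing η ξ with
  | nil =>
    cases η <;> cases ξ <;> simp [coprod, qshw, cat]
  | cons a ν ih =>
    rw [coprod, Finsupp.sub_apply, Finsupp.add_apply, Finsupp.finsetSum_apply]
    rcases η with - | ⟨b, η⟩ <;> rcases ξ with - | ⟨b', ξ⟩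
    · simp [mapDomain_cons_left_nil, mapDomain_cons_right_nil, mapDomain_cons_cons_nil_left,
        qshw_nil_left]
    · simp [mapDomain_cons_left_nil, mapDomain_cons_right_cons, mapDomain_cons_cons_nil_left,
        qshw_nil_left, ih, ite_and]
    · simp [mapDomain_cons_left_cons, mapDomain_cons_right_nil, mapDomain_cons_cons_nil_right,
        qshw_nil_right, ih, ite_and]
    · simp [mapDomain_cons_left_cons, mapDomain_cons_right_cons, mapDomain_cons_cons_cons,
        qshw, cat, ih, mem_brFiber, eq_comm]

theorem qshS_eq_linearCombination (c d : QSeries m) (ν : QWord m) :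
    qshS m c d ν = Finsupp.linearCombination ℝ (fun p => c p.1 * d p.2) (coprod ν) := by
  rw [qshS, Finsupp.linearCombination_apply, Finsupp.sum,
    finsum_eq_sum_of_support_subset (s := (coprod ν).support)]
  · exact Finset.sum_congr rfl fun p _ => by rw [← coprod_apply, smul_eq_mul, mul_comm]
  · intro p hp
    rw [Function.mem_support, ← coprod_apply] at hp
    simpa using right_ne_zero_of_mul hp

variable (m) in
/-- The quasi-shuffle product of series as a bilinear map. -/
def qshBilin : QSeries m →ₗ[ℝ] QSeries m →ₗ[ℝ] QSeries m :=
  LinearMap.mk₂ ℝ (qshS m)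
    (fun c c' d => by
      ext ν
      simp [qshS_eq_linearCombination, Finsupp.linearCombination_apply, Finsupp.sum, add_mul,
        mul_add, Finset.sum_add_distrib])
    (fun r c d => by
      ext ν
      simp [qshS_eq_linearCombination, Finsupp.linearCombination_apply, Finsupp.sum,
        Finset.mul_sum, mul_assoc, mul_left_comm])
    (fun c d d' => by
      ext ν
      simp [qshS_eq_linearCombination, Finsupp.linearCombination_apply, Finsupp.sum,
        mul_add, Finset.sum_add_distrib])
    (fun r c d => by
      ext ν
      simp [qshS_eq_linearCombination, Finsupp.linearCombination_apply, Finsupp.sum,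
        Finset.mul_sum, mul_left_comm])

theorem qshBilin_apply (c d : QSeries m) : qshBilin m c d = qshS m c d := rfl

theorem qshS_zero_left (d : QSeries m) : qshS m 0 d = 0 := by
  rw [← qshBilin_apply, map_zero, LinearMap.zero_apply]

theorem qshS_zero_right (c : QSeries m) : qshS m c 0 = 0 := by
  rw [← qshBilin_apply, map_zero]

/-- The left shift of a quasi-shuffle product. -/
theorem leftShift_qshS (a : Letter m) (c d : QSeries m) :
    leftShift m a (qshS m c d) =
      qshS m (leftShift m a c) d + qshS m c (leftShift m a d)
        - ∑ q ∈ brFiber a, qshS m (leftShift m q.1 c) (leftShift m q.2 d) := by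
  ext ν
  simp only [leftShift, Pi.sub_apply, Pi.add_apply, Finset.sum_apply, qshS_eq_linearCombination,
    coprod, map_sub, map_add, map_sum, Finsupp.linearCombination_mapDomain]
  rfl

/-- Left shifts as linear maps. -/
def leftShiftLin (a : Letter m) : QSeries m →ₗ[ℝ] QSeries m :=
  LinearMap.funLeft ℝ ℝ (a :: ·)

theorem ShiftStable.map₂_qshBilin {V W : Submodule ℝ (QSeries m)} (hV : ShiftStable m V)
    (hW : ShiftStable m W) : ShiftStable m (Submodule.map₂ (qshBilin m) V W) := by
  intro a
  change Submodule.map₂ (qshBilin m) V W ≤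
    (Submodule.map₂ (qshBilin m) V W).comap (leftShiftLin a)
  refine Submodule.map₂_le.2 fun c hc d hd => ?_
  change leftShift m a (qshS m c d) ∈ Submodule.map₂ (qshBilin m) V W
  rw [leftShift_qshS]
  exact sub_mem (add_mem (Submodule.apply_mem_map₂ _ (hV a c hc) hd)
    (Submodule.apply_mem_map₂ _ hc (hW a d hd)))
    (sum_mem fun q _ => Submodule.apply_mem_map₂ _ (hV q.1 c hc) (hW q.2 d hd))

theorem SupportedOn.leftShift {X : Finset (Letter m)} {c : QSeries m} (hc : SupportedOn m X c)
    (a : Letter m) : SupportedOn m X (leftShift m a c) :=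
  fun ν hν => hc (a :: ν) fun h => hν fun b hb => h b (List.mem_cons_of_mem a hb)

theorem SupportedOn.leftShift_eq_zero {X : Finset (Letter m)} {c : QSeries m}
    (hc : SupportedOn m X c) {a : Letter m} (ha : a ∉ X) : QShuffleExt.leftShift m a c = 0 :=
  funext fun ν => hc (a :: ν) fun h => ha (h a List.mem_cons_self)

theorem SupportedOn.qshS {Xc Xd : Finset (Letter m)} {c d : QSeries m}
    (hc : SupportedOn m Xc c) (hd : SupportedOn m Xd d) :
    SupportedOn m (Xc ∪ Xd ∪ brSet m Xc Xd) (qshS m c d) := by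
  intro ν
  induction ν generalizing c d with
  | nil => simp
  | cons a ν ih =>
    intro hν
    change QShuffleExt.leftShift m a (QShuffleExt.qshS m c d) ν = 0
    rw [leftShift_qshS]
    simp only [Pi.sub_apply, Pi.add_apply, Finset.sum_apply]
    by_cases ha : a ∈ Xc ∪ Xd ∪ brSet m Xc Xd
    · have hν' : ¬ ∀ b ∈ ν, b ∈ Xc ∪ Xd ∪ brSet m Xc Xd := fun h =>
        hν (List.forall_mem_cons.2 ⟨ha, h⟩)
      rw [ih (hc.leftShift a) hd hν', ih hc (hd.leftShift a) hν',
        Finset.sum_eq_zero fun q _ => ih (hc.leftShift q.1) (hd.leftShift q.2) hν']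
      simp
    · simp only [Finset.mem_union, not_or] at ha
      rw [hc.leftShift_eq_zero ha.1.1, hd.leftShift_eq_zero ha.1.2, qshS_zero_left,
        qshS_zero_right, Finset.sum_eq_zero]
      · simp
      · intro q hq
        by_cases hq₁ : q.1 ∈ Xc
        · have hq₂ : q.2 ∉ Xd := fun hq₂ => ha.2 <|
            Finset.mem_image.2 ⟨q, Finset.mem_product.2 ⟨hq₁, hq₂⟩, mem_brFiber.1 hq⟩
          rw [hd.leftShift_eq_zero hq₂, qshS_zero_right, Pi.zero_apply]
        · rw [hc.leftShift_eq_zero hq₁, qshS_zero_left, Pi.zero_apply]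

theorem span_image2_qshS (V W : Submodule ℝ (QSeries m)) :
    Submodule.span ℝ (Set.image2 (qshS m) (V : Set (QSeries m)) (W : Set (QSeries m))) =
      Submodule.map₂ (qshBilin m) V W :=
  (Submodule.map₂_eq_span_image2 (qshBilin m) V W).symm

theorem finiteDimensional_map₂_qshBilin {V W : Submodule ℝ (QSeries m)}
    (hV : FiniteDimensional ℝ V) (hW : FiniteDimensional ℝ W) :
    FiniteDimensional ℝ (Submodule.map₂ (qshBilin m) V W) :=
  Module.Finite.iff_fg.2 ((Module.Finite.iff_fg.1 hV).map₂ _ (Module.Finite.iff_fg.1 hW))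

variable (m)

/-- If `c` and `d` are rational over finite sub-alphabets `X_c`
and `X_d` of `X̄`, then `e = c ⊛ d` is rational over
`X_e = X_c ∪ X_d ∪ [X_c X_d]`.  In particular, for any finite-dimensional
left-shift-stable subspaces `V_c ∋ c` and `V_d ∋ d`, the span of all
quasi-shuffles of elements of `V_c` with elements of `V_d` is a
finite-dimensional left-shift-stable subspace containing `e`. -/
theorem qshuffle_preserves_rationality (m : ℕ) (Xc Xd : Finset (Letter m))
    (c d : QSeries m) (hc : IsRationalOn m Xc c) (hd : IsRationalOn m Xd d) :
    IsRationalOn m (Xc ∪ Xd ∪ brSet m Xc Xd) (qshS m c d) ∧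
    ∀ Vc Vd : Submodule ℝ (QSeries m),
      FiniteDimensional ℝ Vc → ShiftStable m Vc → c ∈ Vc →
      FiniteDimensional ℝ Vd → ShiftStable m Vd → d ∈ Vd →
      FiniteDimensional ℝ (Submodule.span ℝ (Set.image2 (qshS m) (Vc : Set (QSeries m)) (Vd : Set (QSeries m)))) ∧
      ShiftStable m (Submodule.span ℝ (Set.image2 (qshS m) (Vc : Set (QSeries m)) (Vd : Set (QSeries m)))) ∧
      qshS m c d ∈ Submodule.span ℝ (Set.image2 (qshS m) (Vc : Set (QSeries m)) (Vd : Set (QSeries m))) := by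
  obtain ⟨hcX, Vc, hVc, hVcs, hcV⟩ := hc
  obtain ⟨hdX, Vd, hVd, hVds, hdV⟩ := hd
  refine ⟨⟨hcX.qshS hdX, Submodule.map₂ (qshBilin m) Vc Vd,
    finiteDimensional_map₂_qshBilin hVc hVd, hVcs.map₂_qshBilin hVds,
    Submodule.apply_mem_map₂ (qshBilin m) hcV hdV⟩, ?_⟩
  intro Wc Wd hWc hWcs hcW hWd hWds hdW
  rw [span_image2_qshS]
  exact ⟨finiteDimensional_map₂_qshBilin hWc hWd, hWcs.map₂_qshBilin hWds,
    Submodule.apply_mem_map₂ (qshBilin m) hcW hdW⟩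

end

end QShuffleExt
end

section
/- For all integers i, j ≥ 0, the quasi-shuffle product of powers of the letter x_1 satisfies x_1^i ⊛ x_1^j = Σ_{k=0}^{min(i,j)} C(i+j−2k, min(i,j)−k) · (x_{1,1}^k ⧢ x_1^{i+j−2k}), where C denotes the binomial coefficient, x_{1,1} = [x_1 x_1], and ⧢ is the shuffle product on words over the alphabet {x_1, x_{1,1}}. -/
open scoped BigOperators

namespace QShuffleStmt

/-!
Alphabet: the letters `x_{1,…,1}` (`n` ones) are encoded by the positive natural
number `n`, so `x_1 = 1`, `x_{1,1} = [x_1 x_1] = 2`, and the commutative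
associative bracket is addition: `[x_a x_b] = a + b`.
Words are lists of letters, and a formal power series is a coefficient
function `List ℕ → ℝ`.
-/

noncomputable section

/-- Left catenation by a letter: `e ↦ a e`. -/
def cat (a : ℕ) (e : List ℕ → ℝ) : List ℕ → ℝ := fun ν =>
  match ν with
  | [] => 0
  | b :: ν' => if b = a then e ν' else 0

/-- The quasi-shuffle product of two words (Hoffman's `+` convention):
`(a v) ⊛ (b w) = a(v ⊛ (b w)) + b((a v) ⊛ w) + [a b](v ⊛ w)`,
`∅ ⊛ η = η ⊛ ∅ = η`. -/
def qshw : List ℕ → List ℕ → (List ℕ → ℝ)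
  | [], ξ => fun ν => if ν = ξ then 1 else 0
  | η, [] => fun ν => if ν = η then 1 else 0
  | a :: v, b :: w =>
      cat a (qshw v (b :: w)) + cat b (qshw (a :: v) w) + cat (a + b) (qshw v w)
  termination_by v w => v.length + w.length

/-- The shuffle product of two words:
`(a η) ⧢ (b ξ) = a(η ⧢ (b ξ)) + b((a η) ⧢ ξ)`, `∅ ⧢ η = η ⧢ ∅ = η`. -/
def shw : List ℕ → List ℕ → (List ℕ → ℝ)
  | [], ξ => fun ν => if ν = ξ then 1 else 0
  | η, [] => fun ν => if ν = η then 1 else 0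
  | a :: v, b :: w => cat a (shw v (b :: w)) + cat b (shw (a :: v) w)
  termination_by v w => v.length + w.length

/-- The shuffle of `x_{1,1}^k` and `x_1^n` is the sum of all words having `k` letters `x_{1,1}`
and `n` letters `x_1`, each with coefficient one. -/
theorem shw_replicate_apply (ν : List ℕ) (k n : ℕ) :
    shw (List.replicate k 2) (List.replicate n 1) ν =
      if (∀ b ∈ ν, b = 1 ∨ b = 2) ∧ ν.count 1 = n ∧ ν.count 2 = k then 1 else 0 := by
  induction ν generalizing k n with
  | nil => cases k <;> cases n <;> simp [shw, cat, List.replicate_succ]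
  | cons b ν ih =>
    have hcat : shw (List.replicate k 2) (List.replicate n 1) (b :: ν) =
        (if b = 2 ∧ 0 < k then shw (List.replicate (k - 1) 2) (List.replicate n 1) ν else 0) +
        (if b = 1 ∧ 0 < n then shw (List.replicate k 2) (List.replicate (n - 1) 1) ν else 0) := by
      cases k <;> cases n <;> simp [shw, cat, List.replicate_succ, ite_and]
      all_goals (rename_i m; cases m <;> simp [shw, List.replicate_succ])
    rw [hcat, ih, ih]
    by_cases h1 : b = 1
    · subst h1
      cases n <;> simp
    by_cases h2 : b = 2
    · subst h2
      cases k <;> simp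
    simp [h1, h2]

/-- The coefficient of a word in `x_1^i ⊛ x_1^j` depends only on the number of its letters
`x_1` and `x_{1,1}`. -/
theorem qshw_replicate_apply (ν : List ℕ) (i j : ℕ) :
    qshw (List.replicate i 1) (List.replicate j 1) ν =
      if (∀ b ∈ ν, b = 1 ∨ b = 2) ∧ ν.count 1 + 2 * ν.count 2 = i + j ∧ ν.count 2 ≤ i then
        ((ν.count 1).choose (i - ν.count 2) : ℝ) else 0 := by
  induction ν generalizing i j with
  | nil => cases i <;> cases j <;> simp [qshw, cat, List.replicate_succ]
  | cons b ν ih =>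
    have hcat : qshw (List.replicate i 1) (List.replicate j 1) (b :: ν) =
        (if b = 1 ∧ 0 < i then qshw (List.replicate (i - 1) 1) (List.replicate j 1) ν else 0) +
        (if b = 1 ∧ 0 < j then qshw (List.replicate i 1) (List.replicate (j - 1) 1) ν else 0) +
        (if b = 2 ∧ 0 < i ∧ 0 < j then
          qshw (List.replicate (i - 1) 1) (List.replicate (j - 1) 1) ν else 0) := by
      cases i <;> cases j <;> simp [qshw, cat, List.replicate_succ, ite_and]
      all_goals (rename_i m; cases m <;> simp [qshw, List.replicate_succ])
    rw [hcat, ih, ih, ih]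
    by_cases hν : ∀ c ∈ ν, c = 1 ∨ c = 2
    swap
    · simp [hν]
    by_cases h1 : b = 1
    · subst h1
      simp only [List.mem_cons, forall_eq_or_imp, eq_true hν, List.count_cons]
      generalize ν.count 1 = p
      generalize ν.count 2 = q
      by_cases h : p + 1 + 2 * q = i + j ∧ q ≤ i
      · obtain ⟨h, hq⟩ := h
        obtain ⟨d, rfl⟩ := Nat.exists_eq_add_of_le hq
        rcases d with _ | d
        · have hj : 0 < j := by omega
          have hs : p + 2 * q = q + (j - 1) := by omega
          have hn : ¬ (0 < q ∧ q ≤ q - 1) := by omega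
          simp_all
        · have hs : p + 2 * q = q + d + j := by omega
          rcases j with _ | j
          · have hp : p.choose (d + 1) = 0 := Nat.choose_eq_zero_of_lt (by omega)
            simp [hs, Nat.choose_succ_succ, hp, h]
          · have hj : q + d + (j + 1) = q + (d + 1) + j := by omega
            simp [hs, hj, Nat.choose_succ_succ, h]
      · have h3 : ¬ (0 < i ∧ p + 2 * q = i - 1 + j ∧ q ≤ i - 1) := by omega
        have h4 : ¬ (0 < j ∧ p + 2 * q = i + (j - 1) ∧ q ≤ i) := by omega
        simp [h, ← ite_and, h3, h4]
    by_cases h2 : b = 2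
    · subst h2
      simp only [List.mem_cons, forall_eq_or_imp, eq_true hν, List.count_cons]
      generalize ν.count 1 = p
      generalize ν.count 2 = q
      rcases i with _ | i
      · simp
      rcases j with _ | j
      · have hp : p + 2 * (q + 1) = i + 1 → q ≤ i → p.choose (i - q) = 0 :=
          fun _ _ => Nat.choose_eq_zero_of_lt (by omega)
        simp +contextual [hp]
      · have hs : p + 2 * (q + 1) = i + 1 + (j + 1) ↔ p + 2 * q = i + j := by omega
        simp [hs]
    simp [h1, h2]

/-- For all `i, j ≥ 0`,
`x_1^i ⊛ x_1^j = Σ_{k=0}^{min(i,j)} C(i+j−2k, min(i,j)−k) (x_{1,1}^k ⧢ x_1^{i+j−2k})`. -/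
theorem qshuffle_powers (i j : ℕ) :
    qshw (List.replicate i 1) (List.replicate j 1)
      = ∑ k ∈ Finset.range (min i j + 1),
          (Nat.choose (i + j - 2 * k) (min i j - k) : ℝ) •
            shw (List.replicate k 2) (List.replicate (i + j - 2 * k) 1) := by
  funext ν
  simp only [qshw_replicate_apply, Finset.sum_apply, Pi.smul_apply, shw_replicate_apply,
    smul_eq_mul, mul_ite, mul_one, mul_zero]
  by_cases h : (∀ b ∈ ν, b = 1 ∨ b = 2) ∧ ν.count 1 + 2 * ν.count 2 = i + j ∧
      ν.count 2 ≤ min i j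
  · obtain ⟨hν, hs, hm⟩ := h
    have hc : ν.count 1 = i + j - 2 * ν.count 2 := by omega
    rw [Finset.sum_eq_single_of_mem (ν.count 2) (by simpa [Nat.lt_succ_iff] using hm)
      (fun k _ hk => if_neg fun h => hk h.2.2.symm),
      if_pos ⟨hν, hs, hm.trans (min_le_left i j)⟩, if_pos ⟨hν, hc, rfl⟩, ← hc]
    rcases le_total i j with hij | hij
    · rw [min_eq_left hij]
    · rw [min_eq_right hij,
        Nat.choose_symm_of_eq_add (b := j - ν.count 2) (by omega)]
  · rw [Finset.sum_eq_zero]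
    · split_ifs with h'
      · rw [Nat.choose_eq_zero_of_lt, Nat.cast_zero]
        by_contra hlt
        exact h ⟨h'.1, h'.2.1, by omega⟩
      · rfl
    · intro k hk
      rw [Finset.mem_range] at hk
      exact if_neg fun h' => h ⟨h'.1, by omega, by omega⟩

end

end QShuffleStmt
end

section
/- Let x_1* := Σ_{k≥0} x_1^k. Then the quasi-shuffle square of x_1* satisfies, for every word η over the alphabet {x_1, x_{1,1}}, (x_1* ⊛ x_1*, η) = 2^{|η|_{x_1}}, where |η|_{x_1} is the number of occurrences of the letter x_1 in η; that is, x_1* ⊛ x_1* = Σ_η 2^{|η|_{x_1}} η. -/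
open scoped BigOperators

namespace QShuffleStmt

/-!
Alphabet: the letters `x_{1,…,1}` (`n` ones) are encoded by the positive natural
number `n`, so `x_1 = 1`, `x_{1,1} = [x_1 x_1] = 2`, and the commutative
associative bracket is addition: `[x_a x_b] = a + b`.
Words are lists of letters, and a formal power series is a coefficient
function `List ℕ → ℝ`.
-/

noncomputable section

open Classical in
/-- The quasi-shuffle product, extended bilinearly to formal power series
(the extension is locally finite, hence well defined). -/
def qshS (c d : List ℕ → ℝ) : List ℕ → ℝ := fun ν =>
  ∑ᶠ p : List ℕ × List ℕ, c p.1 * d p.2 * qshw p.1 p.2 ν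

open Classical in
/-- The series `x_1* = Σ_{k≥0} x_1^k`: coefficient 1 on every word all of whose
letters are `x_1`. -/
def star : List ℕ → ℝ := fun ν => if ∀ a ∈ ν, a = 1 then 1 else 0

/-- A word occurring in `v ⊛ w` is at least as long as each of `v` and `w`. -/
theorem length_le_of_qshw_ne_zero (ν v w : List ℕ) (h : qshw v w ν ≠ 0) :
    v.length ≤ ν.length ∧ w.length ≤ ν.length := by
  induction ν generalizing v w with
  | nil => cases v <;> cases w <;> simp_all [qshw, cat]
  | cons c ν ih =>
    match v, w with
    | [], w =>
      have : c :: ν = w := by simpa [qshw] using h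
      simp [← this]
    | a :: v, [] =>
      have : c :: ν = a :: v := by simpa [qshw] using h
      simp [← this]
    | a :: v, b :: w =>
      by_contra hlen
      have h₁ : qshw v (b :: w) ν = 0 := by
        by_contra h₁
        have := ih _ _ h₁
        simp only [List.length_cons] at this hlen
        omega
      have h₂ : qshw (a :: v) w ν = 0 := by
        by_contra h₂
        have := ih _ _ h₂
        simp only [List.length_cons] at this hlen
        omega
      have h₃ : qshw v w ν = 0 := by
        by_contra h₃
        have := ih _ _ h₃
        simp only [List.length_cons] at this hlen
        omega
      simp [qshw, cat, h₁, h₂, h₃] at h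

/-- The coefficients of `x_1^m ⊛ x_1^n`. -/
def qshPow (m n : ℕ) (ν : List ℕ) : ℝ :=
  qshw (List.replicate m 1) (List.replicate n 1) ν

theorem qshPow_nil (m n : ℕ) : qshPow m n [] = if m = 0 ∧ n = 0 then 1 else 0 := by
  cases m <;> cases n <;> simp [qshPow, qshw, cat, List.replicate_succ]

theorem qshPow_zero_zero_cons (b : ℕ) (ν : List ℕ) : qshPow 0 0 (b :: ν) = 0 := by
  simp [qshPow, qshw]

theorem qshPow_zero_succ_cons (n b : ℕ) (ν : List ℕ) :
    qshPow 0 (n + 1) (b :: ν) = if b = 1 then qshPow 0 n ν else 0 := by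
  simp [qshPow, qshw, List.replicate_succ, ite_and]

theorem qshPow_succ_zero_cons (m b : ℕ) (ν : List ℕ) :
    qshPow (m + 1) 0 (b :: ν) = if b = 1 then qshPow m 0 ν else 0 := by
  cases m <;> simp [qshPow, qshw, List.replicate_succ, ite_and]

theorem qshPow_succ_succ_cons (m n b : ℕ) (ν : List ℕ) :
    qshPow (m + 1) (n + 1) (b :: ν) =
      (if b = 1 then qshPow m (n + 1) ν else 0) + (if b = 1 then qshPow (m + 1) n ν else 0) +
        if b = 2 then qshPow m n ν else 0 := by
  simp [qshPow, qshw, cat, List.replicate_succ]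

open Finset in
theorem sum_range_qshPow (η : List ℕ) (hη : ∀ a ∈ η, a = 1 ∨ a = 2) (M N : ℕ)
    (hM : η.length < M) (hN : η.length < N) :
    ∑ m ∈ range M, ∑ n ∈ range N, qshPow m n η = 2 ^ (η.count 1) := by
  induction η generalizing M N with
  | nil =>
    obtain ⟨M, rfl⟩ := Nat.exists_eq_add_of_lt hM
    obtain ⟨N, rfl⟩ := Nat.exists_eq_add_of_lt hN
    simp [qshPow_nil, sum_range_succ']
  | cons b ν ih =>
    obtain ⟨M, rfl⟩ : ∃ k, M = k + 1 := ⟨M - 1, by omega⟩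
    obtain ⟨N, rfl⟩ : ∃ k, N = k + 1 := ⟨N - 1, by omega⟩
    simp only [List.length_cons, add_lt_add_iff_right] at hM hN
    have ih := ih fun a ha => hη a (List.mem_cons_of_mem _ ha)
    rcases hη b List.mem_cons_self with rfl | rfl
    · have h₁ := ih M (N + 1) hM (by omega)
      have h₂ := ih (M + 1) N (by omega) hN
      simp only [sum_range_succ' _ N, sum_add_distrib] at h₁
      simp only [sum_range_succ' _ M] at h₂
      simp only [sum_range_succ' _ N, sum_range_succ' _ M, qshPow_zero_zero_cons,
        qshPow_zero_succ_cons, qshPow_succ_zero_cons, qshPow_succ_succ_cons, sum_add_distrib]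
      simp only [if_true, OfNat.one_ne_ofNat, if_false, sum_const_zero, add_zero,
        List.count_cons_self, pow_succ]
      linarith
    · have h := ih M N hM hN
      simp [sum_range_succ', qshPow_zero_zero_cons, qshPow_zero_succ_cons, qshPow_succ_zero_cons,
        qshPow_succ_succ_cons, h]

theorem star_replicate (n : ℕ) : star (List.replicate n 1) = 1 := by
  simp [star, List.mem_replicate]

theorem eq_replicate_of_star_ne_zero {v : List ℕ} (h : star v ≠ 0) :
    v = List.replicate v.length 1 := by
  rw [List.eq_replicate_iff]
  simpa [star] using h

open Finset in
/-- The coefficient of `η` in `x_1* ⊛ x_1*` is a finite sum over pairs of exponents. -/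
theorem qshS_star_star (η : List ℕ) :
    qshS star star η =
      ∑ m ∈ range (η.length + 1), ∑ n ∈ range (η.length + 1), qshPow m n η := by
  have hinj : Function.Injective fun p : ℕ × ℕ =>
      (List.replicate p.1 1, List.replicate p.2 1) := by
    intro p q h
    simp only [Prod.mk.injEq] at h
    exact Prod.ext (by simpa using congrArg List.length h.1)
      (by simpa using congrArg List.length h.2)
  rw [qshS, finsum_eq_sum_of_support_subset (s := (range (η.length + 1) ×ˢ
    range (η.length + 1)).map ⟨_, hinj⟩), sum_map, sum_product]
  · simp [star_replicate, qshPow]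
  · rintro ⟨v, w⟩ h
    simp only [Function.mem_support, mul_ne_zero_iff] at h
    obtain ⟨⟨hv, hw⟩, hvw⟩ := h
    have := length_le_of_qshw_ne_zero _ _ _ hvw
    simp only [coe_map, Set.mem_image, mem_coe, mem_product, mem_range]
    exact ⟨(v.length, w.length), ⟨by simp; omega, by simp; omega⟩,
      Prod.ext (eq_replicate_of_star_ne_zero hv).symm (eq_replicate_of_star_ne_zero hw).symm⟩

/-- For every word `η` over the alphabet `{x_1, x_{1,1}}`,
`(x_1* ⊛ x_1*, η) = 2^{|η|_{x_1}}`, i.e. `x_1* ⊛ x_1* = Σ_η 2^{|η|_{x_1}} η`. -/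
theorem qshuffle_star_square (η : List ℕ) (hη : ∀ a ∈ η, a = 1 ∨ a = 2) :
    qshS star star η = 2 ^ (η.count 1) := by
  rw [qshS_star_star]
  exact sum_range_qshPow η hη _ _ (Nat.lt_succ_self _) (Nat.lt_succ_self _)

end

end QShuffleStmt
end
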